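/- arXiv:2108.12840 — 4 statements merged into one kernel-verified Lean document; each statement's English description precedes it below -/
import Mathlib

section
/- Let G be a vertex-weighted graph and let S be an independent set of G that is contained in every maximum weighted independent set of G. Let u ∈ N(S) be a child of S, i.e., w(u) ≥ w(S ∩ N(u)). Then every maximum weighted independent set of G contains at least one vertex of N(u) ∖ N[S]. -/
open scoped Classical

namespace MWIS

variable {V : Type*}

/-- A finset of vertices is an independent set of `G`. -/
def IsIndepSet (G : SimpleGraph V) (s : Finset V) : Prop :=
  ∀ ⦃a⦄, a ∈ s → ∀ ⦃b⦄, b ∈ s → ¬G.Adj a b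

/-- The maximum total weight of an independent set of `G` contained in `A`
(i.e. α of the induced subgraph `G[A]`, with the inherited weights). -/
noncomputable def alphaOn [Fintype V] (G : SimpleGraph V) (w : V → ℝ) (A : Finset V) : ℝ :=
  sSup {x : ℝ | ∃ s : Finset V, s ⊆ A ∧ IsIndepSet G s ∧ x = ∑ v ∈ s, w v}

/-- The maximum total weight of an independent set of `G`. -/
noncomputable def alpha [Fintype V] (G : SimpleGraph V) (w : V → ℝ) : ℝ :=
  alphaOn G w Finset.univ

/-- The open neighborhood of a vertex, as a finset. -/
noncomputable def nbrs [Fintype V] (G : SimpleGraph V) (v : V) : Finset V :=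
  Finset.univ.filter fun u => G.Adj v u

/-- The degree of a vertex. -/
noncomputable def deg [Fintype V] (G : SimpleGraph V) (v : V) : ℕ :=
  (nbrs G v).card

/-- The closed neighborhood `N[v]` of a vertex. -/
noncomputable def closedNbrs [Fintype V] [DecidableEq V] (G : SimpleGraph V) (v : V) : Finset V :=
  insert v (nbrs G v)

/-- The open neighborhood `N(A)` of a vertex set. -/
noncomputable def openNbhd [Fintype V] [DecidableEq V] (G : SimpleGraph V) (A : Finset V) :
    Finset V :=
  (A.biUnion fun v => nbrs G v) \ A

/-- The closed neighborhood `N[A]` of a vertex set. -/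
noncomputable def closedNbhd [Fintype V] [DecidableEq V] (G : SimpleGraph V) (A : Finset V) :
    Finset V :=
  A ∪ A.biUnion fun v => nbrs G v

/-- `s` is a maximum weighted independent set of `G` with weights `w`. -/
def IsMWIS [Fintype V] (G : SimpleGraph V) (w : V → ℝ) (s : Finset V) : Prop :=
  IsIndepSet G s ∧ ∀ t : Finset V, IsIndepSet G t → ∑ v ∈ t, w v ≤ ∑ v ∈ s, w v

/-- `A` is the vertex set of a connected component of the subgraph of `G` induced on `B`:
`A` is the set of vertices reachable from some `x ∈ B` by paths staying inside `B`. -/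
def IsCompOf (G : SimpleGraph V) (B A : Finset V) : Prop :=
  ∃ x ∈ B, ∀ y, y ∈ A ↔ Relation.ReflTransGen (fun a b => a ∈ B ∧ b ∈ B ∧ G.Adj a b) x y

/-- If the independent set `S` is contained in every maximum weighted
independent set of `G` and `u ∈ N(S)` is a child of `S` (i.e. `w(u) ≥ w(S ∩ N(u))`),
then every maximum weighted independent set contains a vertex of `N(u) \ N[S]`. -/
theorem stmt0 [Fintype V] [DecidableEq V] (G : SimpleGraph V) (w : V → ℝ)
    (hw : ∀ x, 0 < w x) (S : Finset V) (hS : IsIndepSet G S)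
    (hSall : ∀ T : Finset V, IsMWIS G w T → S ⊆ T)
    (u : V) (hu : u ∈ openNbhd G S)
    (hchild : ∑ x ∈ S ∩ nbrs G u, w x ≤ w u) :
    ∀ T : Finset V, IsMWIS G w T → ∃ x ∈ nbrs G u \ closedNbhd G S, x ∈ T := by
  intro T hT
  by_contra! hno
  have hST := hSall T hT
  simp only [openNbhd, Finset.mem_sdiff, Finset.mem_biUnion, nbrs, Finset.mem_filter,
    Finset.mem_univ, true_and] at hu
  obtain ⟨⟨s, hsS, hsu⟩, -⟩ := hu
  have huT : u ∉ T := fun h => hT.1 (hST hsS) h hsu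
  have hTN : T ∩ nbrs G u = S ∩ nbrs G u := by
    refine Finset.Subset.antisymm (fun x hx => ?_) (Finset.inter_subset_inter_right hST)
    obtain ⟨hxT, hxu⟩ := Finset.mem_inter.1 hx
    refine Finset.mem_inter.2 ⟨?_, hxu⟩
    by_contra hxS
    refine hno x (Finset.mem_sdiff.2 ⟨hxu, fun hxc => ?_⟩) hxT
    rcases Finset.mem_union.1 hxc with h | h
    · exact hxS h
    · obtain ⟨y, hyS, hyx⟩ := Finset.mem_biUnion.1 h
      exact hT.1 (hST hyS) hxT (Finset.mem_filter.1 hyx).2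
  -- Exchanging the neighbors of `u` in `T` for `u` yields another maximum independent set.
  have hexch : IsMWIS G w (insert u (T \ nbrs G u)) := by
    have hnot : ∀ b ∈ T \ nbrs G u, ¬G.Adj u b := fun b hb hub =>
      (Finset.mem_sdiff.1 hb).2 (Finset.mem_filter.2 ⟨Finset.mem_univ b, hub⟩)
    refine ⟨fun a ha b hb hab => ?_, fun t ht => (hT.2 t ht).trans ?_⟩
    · rcases Finset.mem_insert.1 ha with rfl | ha' <;> rcases Finset.mem_insert.1 hb with rfl | hb'
      · exact G.irrefl hab
      · exact hnot b hb' hab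
      · exact hnot a ha' hab.symm
      · exact hT.1 (Finset.mem_sdiff.1 ha').1 (Finset.mem_sdiff.1 hb').1 hab
    · rw [Finset.sum_insert fun h => huT (Finset.mem_sdiff.1 h).1,
        ← Finset.sum_inter_add_sum_sdiff T (nbrs G u), hTN]
      gcongr
  rcases Finset.mem_insert.1 (hSall _ hexch hsS) with rfl | h
  · exact G.irrefl hsu
  · exact (Finset.mem_sdiff.1 h).2 (Finset.mem_filter.2 ⟨Finset.mem_univ s, hsu.symm⟩)

end MWIS
end

section
/- Let G be a vertex-weighted graph and let v be a vertex whose open neighborhood N(v) induces a clique in G and such that w(v) < w(u) for every u ∈ N(v). Let G' be the graph obtained from G by deleting v and replacing the weight of each u ∈ N(v) by w(u)−w(v). Then α(G)=α(G')+w(v). -/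
open scoped Classical

namespace MWIS

variable {V : Type*}

theorem sum_le_alphaOn [Fintype V] (G : SimpleGraph V) (w : V → ℝ) {A s : Finset V}
    (hsA : s ⊆ A) (hs : IsIndepSet G s) : ∑ x ∈ s, w x ≤ alphaOn G w A := by
  refine le_csSup (Set.Finite.bddAbove ?_) ⟨s, hsA, hs, rfl⟩
  refine (Set.finite_range fun t : Finset V => ∑ x ∈ t, w x).subset ?_
  rintro _ ⟨t, -, -, rfl⟩
  exact ⟨t, rfl⟩

theorem alphaOn_le [Fintype V] (G : SimpleGraph V) (w : V → ℝ) {A : Finset V} {c : ℝ}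
    (h : ∀ s ⊆ A, IsIndepSet G s → ∑ x ∈ s, w x ≤ c) : alphaOn G w A ≤ c := by
  refine csSup_le ⟨_, ∅, Finset.empty_subset A, by simp [IsIndepSet], rfl⟩ ?_
  rintro _ ⟨s, hsA, hs, rfl⟩
  exact h s hsA hs

theorem IsIndepSet.mono {G : SimpleGraph V} {s t : Finset V} (ht : IsIndepSet G t) (h : s ⊆ t) :
    IsIndepSet G s :=
  fun _ ha _ hb => ht (h ha) (h hb)

/-- Lowering the weights on a set `N` by `c` lowers the weight of `s` by `c` for each element of
`s` in `N`. -/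
theorem sum_ite_sub [DecidableEq V] (w : V → ℝ) (c : ℝ) (s N : Finset V) :
    ∑ x ∈ s, (if x ∈ N then w x - c else w x) = ∑ x ∈ s, w x - (s ∩ N).card * c := by
  have h : ∀ x ∈ s, (if x ∈ N then w x - c else w x) = w x - if x ∈ N then c else 0 := by
    intro x _
    split_ifs <;> simp
  rw [Finset.sum_congr rfl h, Finset.sum_sub_distrib, Finset.sum_ite_mem, Finset.sum_const,
    nsmul_eq_mul]

theorem IsIndepSet.card_inter_le_one [DecidableEq V] {G : SimpleGraph V} {s N : Finset V}
    (hs : IsIndepSet G s) (hN : ∀ a ∈ N, ∀ b ∈ N, a ≠ b → G.Adj a b) : (s ∩ N).card ≤ 1 := by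
  refine Finset.card_le_one.2 fun a ha b hb => ?_
  rw [Finset.mem_inter] at ha hb
  by_contra hab
  exact hs ha.1 hb.1 (hN a ha.2 b hb.2 hab)

theorem IsIndepSet.inter_nbrs_eq_empty [Fintype V] [DecidableEq V] {G : SimpleGraph V}
    {s : Finset V} {v : V} (hs : IsIndepSet G s) (hv : v ∈ s) : s ∩ nbrs G v = ∅ := by
  refine Finset.eq_empty_of_forall_notMem fun u hu => ?_
  rw [Finset.mem_inter, nbrs, Finset.mem_filter] at hu
  exact hs hv hu.1 hu.2.2

theorem IsIndepSet.insert_of_inter_nbrs_eq_empty [Fintype V] [DecidableEq V] {G : SimpleGraph V}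
    {s : Finset V} {v : V} (hs : IsIndepSet G s) (h : s ∩ nbrs G v = ∅) :
    IsIndepSet G (insert v s) := by
  have hv : ∀ u ∈ s, ¬G.Adj v u := fun u hu huv =>
    Finset.notMem_empty u (h ▸ Finset.mem_inter.2 ⟨hu, by simpa [nbrs] using huv⟩)
  intro a ha b hb hab
  rcases Finset.mem_insert.1 ha with rfl | has <;>
    rcases Finset.mem_insert.1 hb with rfl | hbs
  · exact G.loopless.irrefl _ hab
  · exact hv b hbs hab
  · exact hv a has hab.symm
  · exact hs has hbs hab

/-- if `N(v)` induces a clique and `w(v) < w(u)` for every `u ∈ N(v)`,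
then deleting `v` and subtracting `w(v)` from the weight of each neighbor of `v`
gives `α(G) = α(G') + w(v)`. -/
theorem stmt3 [Fintype V] [DecidableEq V] (G : SimpleGraph V) (w : V → ℝ)
    (hw : ∀ x, 0 < w x) (v : V)
    (hclique : ∀ a ∈ nbrs G v, ∀ b ∈ nbrs G v, a ≠ b → G.Adj a b)
    (hlt : ∀ u ∈ nbrs G v, w v < w u) :
    alpha G w =
      alphaOn G (fun x => if x ∈ nbrs G v then w x - w v else w x) (Finset.univ \ {v})
        + w v := by
  apply le_antisymm
  · refine alphaOn_le G w fun s _ hs => ?_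
    have hsub : s.erase v ⊆ Finset.univ \ {v} := fun x hx => by
      simpa using Finset.ne_of_mem_erase hx
    have hle := sum_le_alphaOn G (fun x => if x ∈ nbrs G v then w x - w v else w x) hsub
      (hs.mono (Finset.erase_subset v s))
    rw [sum_ite_sub] at hle
    by_cases hv : v ∈ s
    · rw [Finset.erase_inter, hs.inter_nbrs_eq_empty hv] at hle
      have hsum := Finset.sum_erase_add s w hv
      simp only [Finset.erase_empty, Finset.card_empty, Nat.cast_zero, zero_mul, sub_zero] at hle
      linarith
    · rw [Finset.erase_eq_of_notMem hv] at hle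
      have hcard : ((s ∩ nbrs G v).card : ℝ) ≤ 1 := by
        exact_mod_cast hs.card_inter_le_one hclique
      have hmul := mul_le_mul_of_nonneg_right hcard (hw v).le
      linarith
  · rw [← le_sub_iff_add_le]
    refine alphaOn_le G _ fun t htA ht => ?_
    rw [sum_ite_sub]
    rcases (t ∩ nbrs G v).eq_empty_or_nonempty with h | h
    · have hv : v ∉ t := fun hv => by simpa using htA hv
      have hle := sum_le_alphaOn G w (Finset.subset_univ _) (ht.insert_of_inter_nbrs_eq_empty h)
      rw [Finset.sum_insert hv] at hle
      rw [h, Finset.card_empty, Nat.cast_zero, zero_mul, alpha]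
      linarith
    · have hcard : (1 : ℝ) ≤ (t ∩ nbrs G v).card := by exact_mod_cast h.card_pos
      have hmul := mul_le_mul_of_nonneg_right hcard (hw v).le
      have hle := sum_le_alphaOn G w (Finset.subset_univ _) ht
      rw [alpha]
      linarith

end MWIS
end

section
/- Let G be a vertex-weighted graph containing a 6-cycle v₁v₂v₃v₄v₅v₆ (edges v₁v₂, v₂v₃, v₃v₄, v₄v₅, v₅v₆, v₆v₁ on six distinct vertices) such that d(v₂)=d(v₃)=d(v₅)=d(v₆)=2, w(v₁) ≥ max{w(v₂),w(v₆)}, w(v₄) ≥ max{w(v₃),w(v₅)}, w(v₆) ≥ w(v₅), and w(v₂) < w(v₃). Let G' be the graph obtained from G by removing v₆, adding the edge v₁v₅, and replacing (in terms of the original weights of G) the weight of v₂ by w(v₂)+w(v₆), the weight of v₃ by w(v₃)+w(v₅), and the weight of v₅ by w(v₆)+w(v₃)−max{w(v₂)+w(v₆), w(v₃)+w(v₅)}. Then α(G) = α(G'). -/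
open scoped Classical

namespace MWIS

variable {V : Type*}

theorem alphaOn_le_alphaOn [Fintype V] {G H : SimpleGraph V} {w w' : V → ℝ} {A B : Finset V}
    (h : ∀ s ⊆ A, IsIndepSet G s →
      ∃ t ⊆ B, IsIndepSet H t ∧ ∑ v ∈ s, w v ≤ ∑ v ∈ t, w' v) :
    alphaOn G w A ≤ alphaOn H w' B := by
  have hbdd : BddAbove {x : ℝ | ∃ s : Finset V, s ⊆ B ∧ IsIndepSet H s ∧ x = ∑ v ∈ s, w' v} := by
    refine ((Set.finite_univ (α := Finset V)).image fun s => ∑ v ∈ s, w' v).bddAbove.mono ?_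
    rintro x ⟨s, -, -, rfl⟩
    exact ⟨s, Set.mem_univ s, rfl⟩
  refine csSup_le ⟨0, ∅, Finset.empty_subset A, fun a ha => by simp at ha, by simp⟩ ?_
  rintro x ⟨s, hsA, hs, rfl⟩
  obtain ⟨t, htB, ht, hle⟩ := h s hsA hs
  exact hle.trans (le_csSup hbdd ⟨t, htB, ht, rfl⟩)

/-- Replacing the part of an independent set of `G` inside `C` by `X ⊆ C` yields an independent
set of `H` of at least the same weight, provided `G` and `H` and their weights agree outside `C`,
`X` is compatible with what is kept, and `X` is at least as heavy as what it replaces. -/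
theorem exists_exchange [DecidableEq V] {G H : SimpleGraph V} {w w' : V → ℝ}
    {s B C X : Finset V} (hs : IsIndepSet G s) (hsB : s \ C ⊆ B) (hXB : X ⊆ B) (hXC : X ⊆ C)
    (hadj : ∀ a b, a ∉ C → b ∉ C → H.Adj a b → G.Adj a b)
    (hX : IsIndepSet H X) (hXs : ∀ x ∈ X, ∀ y ∈ s, y ∉ C → ¬H.Adj x y)
    (hww' : ∀ a, a ∉ C → w a = w' a)
    (hle : ∑ v ∈ C, (if v ∈ s then w v else 0) ≤ ∑ v ∈ X, w' v) :
    ∃ t ⊆ B, IsIndepSet H t ∧ ∑ v ∈ s, w v ≤ ∑ v ∈ t, w' v := by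
  refine ⟨s \ C ∪ X, Finset.union_subset hsB hXB, ?_, ?_⟩
  · intro a ha b hb hab
    rw [Finset.mem_union, Finset.mem_sdiff] at ha hb
    rcases ha with ⟨ha, haC⟩ | ha <;> rcases hb with ⟨hb, hbC⟩ | hb
    · exact hs ha hb (hadj a b haC hbC hab)
    · exact hXs b hb a ha haC hab.symm
    · exact hXs a ha b hb hbC hab
    · exact hX ha hb hab
  · have hdisj : Disjoint (s \ C) X := Finset.sdiff_disjoint.mono_right hXC
    rw [Finset.sum_union hdisj, ← Finset.sum_inter_add_sum_sdiff s C w, add_comm]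
    refine add_le_add (Finset.sum_le_sum fun a ha => ?_) ?_
    · exact (hww' a (Finset.mem_sdiff.1 ha).2).le
    · rwa [Finset.inter_comm, ← Finset.sum_ite_mem]

theorem isIndepSet_pair [DecidableEq V] {G : SimpleGraph V} {a b : V} (h : ¬G.Adj a b) :
    IsIndepSet G {a, b} := by
  intro x hx y hy
  rw [Finset.mem_insert, Finset.mem_singleton] at hx hy
  rcases hx with rfl | rfl <;> rcases hy with rfl | rfl
  · exact G.irrefl
  · exact h
  · exact fun h' => h h'.symm
  · exact G.irrefl

theorem adj_iff_of_deg_eq_two [Fintype V] [DecidableEq V] {G : SimpleGraph V} {v a b : V}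
    (hd : deg G v = 2) (ha : G.Adj v a) (hb : G.Adj v b) (hab : a ≠ b) (x : V) :
    G.Adj v x ↔ x = a ∨ x = b := by
  have hsub : ({a, b} : Finset V) ⊆ nbrs G v := by
    intro y hy
    rw [Finset.mem_insert, Finset.mem_singleton] at hy
    rcases hy with rfl | rfl <;> simpa [nbrs]
  have heq := Finset.eq_of_subset_of_card_le hsub
    (by rw [Finset.card_pair hab]; exact hd.le)
  have hx : x ∈ nbrs G v ↔ x ∈ ({a, b} : Finset V) := by rw [heq]
  simpa [nbrs] using hx

/-- for a 6-cycle `v₁v₂v₃v₄v₅v₆` with `d(v₂)=d(v₃)=d(v₅)=d(v₆)=2`,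
`w(v₁) ≥ max{w(v₂), w(v₆)}`, `w(v₄) ≥ max{w(v₃), w(v₅)}`, `w(v₆) ≥ w(v₅)` and
`w(v₂) < w(v₃)`: remove `v₆`, add the edge `v₁v₅`, and replace (in terms of the
original weights) the weight of `v₂` by `w(v₂)+w(v₆)`, of `v₃` by `w(v₃)+w(v₅)`,
and of `v₅` by `w(v₆)+w(v₃) − max{w(v₂)+w(v₆), w(v₃)+w(v₅)}`. Then `α(G) = α(G')`. -/
theorem stmt12 [Fintype V] [DecidableEq V] (G : SimpleGraph V) (w : V → ℝ)
    (hw : ∀ x, 0 < w x) (v₁ v₂ v₃ v₄ v₅ v₆ : V)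
    (hdist : List.Pairwise (· ≠ ·) [v₁, v₂, v₃, v₄, v₅, v₆])
    (e12 : G.Adj v₁ v₂) (e23 : G.Adj v₂ v₃) (e34 : G.Adj v₃ v₄) (e45 : G.Adj v₄ v₅)
    (e56 : G.Adj v₅ v₆) (e61 : G.Adj v₆ v₁)
    (hd2 : deg G v₂ = 2) (hd3 : deg G v₃ = 2) (hd5 : deg G v₅ = 2) (hd6 : deg G v₆ = 2)
    (hw1 : max (w v₂) (w v₆) ≤ w v₁) (hw4 : max (w v₃) (w v₅) ≤ w v₄)
    (hw65 : w v₅ ≤ w v₆) (hw23 : w v₂ < w v₃) :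
    alpha G w =
      alphaOn (G ⊔ SimpleGraph.fromRel fun x y => x = v₁ ∧ y = v₅)
        (Function.update (Function.update (Function.update w v₂ (w v₂ + w v₆))
          v₃ (w v₃ + w v₅))
          v₅ (w v₆ + w v₃ - max (w v₂ + w v₆) (w v₃ + w v₅)))
        (Finset.univ \ {v₆}) := by
  simp only [List.pairwise_cons, List.mem_cons, List.not_mem_nil, or_false, forall_eq_or_imp,
    forall_eq] at hdist
  obtain ⟨⟨n12, n13, n14, n15, n16⟩, ⟨n23, n24, n25, n26⟩, ⟨n34, n35, n36⟩, ⟨n45, n46⟩, n56, -⟩ :=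
    hdist
  have a2 := adj_iff_of_deg_eq_two hd2 e12.symm e23 n13
  have a3 := adj_iff_of_deg_eq_two hd3 e23.symm e34 n24
  have a5 := adj_iff_of_deg_eq_two hd5 e45.symm e56 n46
  have a6 := adj_iff_of_deg_eq_two hd6 e56.symm e61 n15.symm
  set H := G ⊔ SimpleGraph.fromRel fun x y => x = v₁ ∧ y = v₅ with hH
  have hHadj : ∀ x y, H.Adj x y ↔ G.Adj x y ∨ (x = v₁ ∧ y = v₅) ∨ (x = v₅ ∧ y = v₁) := by
    intro x y
    simp only [hH, SimpleGraph.sup_adj, SimpleGraph.fromRel_adj]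
    grind
  set w' := Function.update (Function.update (Function.update w v₂ (w v₂ + w v₆))
    v₃ (w v₃ + w v₅)) v₅ (w v₆ + w v₃ - max (w v₂ + w v₆) (w v₃ + w v₅)) with hw'
  have w2 : w' v₂ = w v₂ + w v₆ := by simp [hw', n23, n25]
  have w3 : w' v₃ = w v₃ + w v₅ := by simp [hw', n35]
  have w5 : w' v₅ = w v₆ + w v₃ - max (w v₂ + w v₆) (w v₃ + w v₅) := by simp [hw']
  have hww' : ∀ a, a ∉ ({v₂, v₃, v₅, v₆} : Finset V) → w a = w' a := by
    intro a ha
    simp only [Finset.mem_insert, Finset.mem_singleton, not_or] at ha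
    simp [hw', ha]
  clear_value H w'
  have p2 := hw v₂
  have p3 := hw v₃
  have p5 := hw v₅
  have p6 := hw v₆
  have hsum : ∀ f : V → ℝ, ∑ v ∈ ({v₂, v₃, v₅, v₆} : Finset V), f v
      = f v₂ + (f v₃ + (f v₅ + f v₆)) := by
    intro f
    rw [Finset.sum_insert (by simp [*]), Finset.sum_insert (by simp [*]), Finset.sum_pair n56]
  apply le_antisymm
  · refine alphaOn_le_alphaOn fun s _ hs => ?_
    have key : ∀ X ⊆ ({v₂, v₃, v₅} : Finset V), IsIndepSet H X →
        (∀ x ∈ X, ∀ y ∈ s, y ∉ ({v₂, v₃, v₅, v₆} : Finset V) → ¬H.Adj x y) →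
        ∑ v ∈ ({v₂, v₃, v₅, v₆} : Finset V), (if v ∈ s then w v else 0) ≤ ∑ v ∈ X, w' v →
        ∃ t ⊆ Finset.univ \ {v₆}, IsIndepSet H t ∧ ∑ v ∈ s, w v ≤ ∑ v ∈ t, w' v := by
      intro X hXC hX hXs hle
      refine exists_exchange hs ?_ ?_ ?_ ?_ hX hXs hww' hle <;> grind
    have s23 : ¬(v₂ ∈ s ∧ v₃ ∈ s) := fun h => hs h.1 h.2 e23
    have s56 : ¬(v₅ ∈ s ∧ v₆ ∈ s) := fun h => hs h.1 h.2 e56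
    rw [hsum] at key
    by_cases s1 : v₁ ∈ s
    · have s2 : v₂ ∉ s := fun h => hs s1 h e12
      have s6 : v₆ ∉ s := fun h => hs h s1 e61
      by_cases s4 : v₄ ∈ s
      · have s3 : v₃ ∉ s := fun h => hs h s4 e34
        have s5 : v₅ ∉ s := fun h => hs s4 h e45
        exact key ∅ (by simp) (by simp [IsIndepSet]) (by simp) (by simp [*])
      · refine key {v₃} (by simp) (by simp [IsIndepSet]) (by grind) ?_
        rw [Finset.sum_singleton]
        grind
    · by_cases s4 : v₄ ∈ s
      · have s3 : v₃ ∉ s := fun h => hs h s4 e34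
        have s5 : v₅ ∉ s := fun h => hs s4 h e45
        refine key {v₂} (by simp) (by simp [IsIndepSet]) (by grind) ?_
        rw [Finset.sum_singleton]
        grind
      · rcases le_total (w v₂ + w v₆) (w v₃ + w v₅) with hle | hle
        · refine key {v₃, v₅} (by grind) (isIndepSet_pair (by grind only)) (by grind) ?_
          rw [Finset.sum_pair n35, w3, w5, max_eq_right hle]
          grind
        · refine key {v₂, v₅} (by grind) (isIndepSet_pair (by grind only)) (by grind) ?_
          rw [Finset.sum_pair n25, w2, w5, max_eq_left hle]
          grind
  · refine alphaOn_le_alphaOn fun s hsA hs => ?_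
    have key : ∀ X ⊆ ({v₂, v₃, v₅, v₆} : Finset V), IsIndepSet G X →
        (∀ x ∈ X, ∀ y ∈ s, y ∉ ({v₂, v₃, v₅, v₆} : Finset V) → ¬G.Adj x y) →
        ∑ v ∈ ({v₂, v₃, v₅, v₆} : Finset V), (if v ∈ s then w' v else 0) ≤ ∑ v ∈ X, w v →
        ∃ t ⊆ Finset.univ, IsIndepSet G t ∧ ∑ v ∈ s, w' v ≤ ∑ v ∈ t, w v := by
      intro X hXC hX hXs hle
      exact exists_exchange hs (Finset.subset_univ _) (Finset.subset_univ _) hXC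
        (fun a b _ _ h => (hHadj a b).2 (Or.inl h)) hX hXs (fun a ha => (hww' a ha).symm) hle
    have s6 : v₆ ∉ s := fun h => by simpa using hsA h
    have s23 : ¬(v₂ ∈ s ∧ v₃ ∈ s) := fun h => hs h.1 h.2 ((hHadj _ _).2 (Or.inl e23))
    have m1 := le_max_left (w v₂ + w v₆) (w v₃ + w v₅)
    have m2 := le_max_right (w v₂ + w v₆) (w v₃ + w v₅)
    have m3 : max (w v₂ + w v₆) (w v₃ + w v₅) ≤ w v₃ + w v₆ := max_le (by linarith) (by linarith)
    generalize max (w v₂ + w v₆) (w v₃ + w v₅) = m at w5 m1 m2 m3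
    rw [hsum] at key
    by_cases s1 : v₁ ∈ s
    · have s2 : v₂ ∉ s := fun h => hs s1 h ((hHadj _ _).2 (Or.inl e12))
      have s5 : v₅ ∉ s := fun h => hs s1 h ((hHadj _ _).2 (Or.inr (Or.inl ⟨rfl, rfl⟩)))
      by_cases s4 : v₄ ∈ s
      · have s3 : v₃ ∉ s := fun h => hs h s4 ((hHadj _ _).2 (Or.inl e34))
        exact key ∅ (by simp) (by simp [IsIndepSet]) (by simp) (by simp [*])
      · refine key {v₃, v₅} (by grind)
          (isIndepSet_pair (by grind only)) (by grind) ?_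
        rw [Finset.sum_pair n35]
        grind
    · by_cases s4 : v₄ ∈ s
      · have s3 : v₃ ∉ s := fun h => hs h s4 ((hHadj _ _).2 (Or.inl e34))
        have s5 : v₅ ∉ s := fun h => hs s4 h ((hHadj _ _).2 (Or.inl e45))
        refine key {v₂, v₆} (by grind)
          (isIndepSet_pair (by grind only)) (by grind) ?_
        rw [Finset.sum_pair n26]
        grind
      · refine key {v₃, v₆} (by grind)
          (isIndepSet_pair (by grind only)) (by grind) ?_
        rw [Finset.sum_pair n36]
        grind

end MWIS
end

section
/- Let G be a vertex-weighted graph containing a 5-cycle v₁v₂v₃v₄v₅ (edges v₁v₂, v₂v₃, v₃v₄, v₄v₅, v₅v₁ on five distinct vertices) with d(v₂)=d(v₃)=d(v₅)=2. Then every maximum weighted independent set S of G contains exactly two vertices of the cycle, i.e., |S ∩ {v₁,v₂,v₃,v₄,v₅}| = 2. -/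
open scoped Classical

namespace MWIS

variable {V : Type*}

/-- A maximum weighted independent set for positive weights is a dominating set. -/
theorem IsMWIS.exists_adj [Fintype V] {G : SimpleGraph V} {w : V → ℝ} (hw : ∀ x, 0 < w x)
    {S : Finset V} (hS : IsMWIS G w S) {x : V} (hx : x ∉ S) : ∃ u ∈ S, G.Adj x u := by
  by_contra! h
  have hindep : IsIndepSet G (insert x S) := by
    intro a ha b hb hab
    rcases Finset.mem_insert.1 ha with rfl | haS <;>
      rcases Finset.mem_insert.1 hb with rfl | hbS
    · exact G.loopless.irrefl _ hab
    · exact h b hbS hab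
    · exact h a haS hab.symm
    · exact hS.1 haS hbS hab
  have hle := hS.2 _ hindep
  rw [Finset.sum_insert hx] at hle
  linarith [hw x]

/-- The neighbors of a vertex of degree two are any two distinct known neighbors. -/
theorem eq_or_eq_of_deg_eq_two [Fintype V] {G : SimpleGraph V} {x a b u : V}
    (hd : deg G x = 2) (hab : a ≠ b) (ha : G.Adj x a) (hb : G.Adj x b) (hu : G.Adj x u) :
    u = a ∨ u = b := by
  have hsub : ({a, b} : Finset V) ⊆ nbrs G x := by
    intro y hy
    rcases Finset.mem_insert.1 hy with rfl | hy
    · simpa [nbrs] using ha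
    · rw [Finset.mem_singleton.1 hy]
      simpa [nbrs] using hb
  have heq : ({a, b} : Finset V) = nbrs G x :=
    Finset.eq_of_subset_of_card_le hsub (by rw [Finset.card_pair hab]; exact hd.le)
  have hmem : u ∈ ({a, b} : Finset V) := by
    rw [heq]
    simpa [nbrs] using hu
  simpa using hmem

/-- A maximum weighted independent set meets the closed neighborhood of a degree-two vertex. -/
theorem IsMWIS.mem_of_deg_eq_two [Fintype V] {G : SimpleGraph V} {w : V → ℝ}
    (hw : ∀ x, 0 < w x) {S : Finset V} (hS : IsMWIS G w S) {x a b : V}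
    (hd : deg G x = 2) (hab : a ≠ b) (ha : G.Adj x a) (hb : G.Adj x b) :
    x ∈ S ∨ a ∈ S ∨ b ∈ S := by
  by_cases hx : x ∈ S
  · exact Or.inl hx
  · obtain ⟨u, huS, hu⟩ := hS.exists_adj hw hx
    rcases eq_or_eq_of_deg_eq_two hd hab ha hb hu with rfl | rfl
    · exact Or.inr (Or.inl huS)
    · exact Or.inr (Or.inr huS)

/-- for a 5-cycle `v₁v₂v₃v₄v₅` with `d(v₂) = d(v₃) = d(v₅) = 2`,
every maximum weighted independent set contains exactly two vertices of the cycle. -/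
theorem stmt18 [Fintype V] [DecidableEq V] (G : SimpleGraph V) (w : V → ℝ)
    (hw : ∀ x, 0 < w x) (v₁ v₂ v₃ v₄ v₅ : V)
    (hdist : List.Pairwise (· ≠ ·) [v₁, v₂, v₃, v₄, v₅])
    (e12 : G.Adj v₁ v₂) (e23 : G.Adj v₂ v₃) (e34 : G.Adj v₃ v₄) (e45 : G.Adj v₄ v₅)
    (e51 : G.Adj v₅ v₁)
    (hd2 : deg G v₂ = 2) (hd3 : deg G v₃ = 2) (hd5 : deg G v₅ = 2)
    (S : Finset V) (hS : IsMWIS G w S) :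
    (S ∩ {v₁, v₂, v₃, v₄, v₅}).card = 2 := by
  simp only [List.pairwise_cons, List.mem_cons, List.not_mem_nil, or_false, forall_eq_or_imp,
    forall_eq] at hdist
  obtain ⟨⟨h12, h13, h14, h15⟩, ⟨h23, h24, h25⟩, ⟨h34, h35⟩, h45, -⟩ := hdist
  have m2 := hS.mem_of_deg_eq_two hw hd2 h13 e12.symm e23
  have m3 := hS.mem_of_deg_eq_two hw hd3 h24 e23.symm e34
  have m5 := hS.mem_of_deg_eq_two hw hd5 h14 e51 e45.symm
  have n12 : v₁ ∈ S → v₂ ∉ S := fun h h' => hS.1 h h' e12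
  have n23 : v₂ ∈ S → v₃ ∉ S := fun h h' => hS.1 h h' e23
  have n34 : v₃ ∈ S → v₄ ∉ S := fun h h' => hS.1 h h' e34
  have n45 : v₄ ∈ S → v₅ ∉ S := fun h h' => hS.1 h h' e45
  have n51 : v₅ ∈ S → v₁ ∉ S := fun h h' => hS.1 h h' e51
  have hcard : (S ∩ {v₁, v₂, v₃, v₄, v₅}).card =
      (if v₁ ∈ S then 1 else 0) + ((if v₂ ∈ S then 1 else 0) + ((if v₃ ∈ S then 1 else 0) +
        ((if v₄ ∈ S then 1 else 0) + (if v₅ ∈ S then 1 else 0)))) := by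
    rw [Finset.inter_comm, ← Finset.filter_mem_eq_inter, Finset.card_filter,
      Finset.sum_insert (by simp [*]), Finset.sum_insert (by simp [*]),
      Finset.sum_insert (by simp [*]), Finset.sum_insert (by simp [*]), Finset.sum_singleton]
  rw [hcard]
  by_cases k1 : v₁ ∈ S <;> by_cases k2 : v₂ ∈ S <;> by_cases k3 : v₃ ∈ S <;>
    by_cases k4 : v₄ ∈ S <;> by_cases k5 : v₅ ∈ S <;> simp_all

end MWIS
end
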